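/- Fix ε > 0, δ ∈ (0,1), and a natural number λ with λ ≥ 20·((e^ε+1)/(e^ε-1))²·ln(2/δ). Consider the online algorithm Q_ZSUM on bit streams x ∈ {0,1}^n: it initializes its internal state I_0 as a draw from Binomial(λ, 1/2); upon reading x_i it sets I_i = I_{i-1} + x_i; at the end of the stream it draws η ∼ Binomial(λ, 1/2) independently and outputs c̃ = I_n + η. Then Q_ZSUM is (ε, δ)-pan-private, and for every stream x its output always satisfies 0 ≤ c̃ - Σ_{i=1}^n x_i ≤ 2λ; in particular the error is at most 2λ. -/

import Mathlib

open scoped ENNReal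

/-- `Binomial(λ, 1/2)` as a distribution on `ℕ`. -/
noncomputable def binomHalf (l : ℕ) : PMF ℕ :=
  (PMF.binomial (1 / 2) (by simp [ENNReal.div_le_iff]) l).map Fin.val

/-- Streams differing in at most one element. -/
def Neighbor {α : Type*} {n : ℕ} (x x' : Fin n → α) : Prop :=
  ∃ i, ∀ j, j ≠ i → x j = x' j

/-- Joint distribution of (internal state at time `t`, final output) of
`Q_ZSUM` on the bit stream `x`: the counter is initialized with
`I₀ ∼ Binomial(λ, 1/2)`, incremented by each stream bit, and an independent
`η ∼ Binomial(λ, 1/2)` is added at the end; the output is the final noisy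
count `c̃ = Iₙ + η`. -/
noncomputable def zsumJoint (lam n : ℕ) (x : Fin n → Fin 2) (t : ℕ) :
    PMF (ℕ × ℕ) :=
  (binomHalf lam).bind fun a =>
    (binomHalf lam).map fun b =>
      (a + ∑ i ∈ Finset.univ.filter (fun i : Fin n => (i : ℕ) < t), (x i : ℕ),
       a + (∑ i, (x i : ℕ)) + b)

lemma binomHalf_apply (l k : ℕ) :
    binomHalf l k = ENNReal.ofReal ((l.choose k : ℝ) / 2 ^ l) := by
  rw [binomHalf, PMF.map_apply, tsum_fintype]
  by_cases hk : k < l + 1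
  · rw [Finset.sum_eq_single_of_mem ⟨k, hk⟩ (Finset.mem_univ _)]
    · have hkl : k ≤ l := by omega
      have h1 : ((1 : NNReal) - 1 / 2) = 1 / 2 := by
        rw [tsub_eq_iff_eq_add_of_le (by simp)]
        exact (add_halves 1).symm
      have h2 : ((1 / 2 : NNReal) ^ k * (1 / 2) ^ (l - k) * (l.choose k : NNReal)) =
          (l.choose k : NNReal) / 2 ^ l := by
        rw [← pow_add, Nat.add_sub_cancel' hkl, one_div, inv_pow, mul_comm, div_eq_mul_inv]
      have h3 : ENNReal.ofReal ((l.choose k : ℝ) / 2 ^ l) =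
          (((l.choose k : NNReal) / 2 ^ l : NNReal) : ℝ≥0∞) := by
        rw [ENNReal.ofReal, Real.toNNReal_of_nonneg (by positivity)]
        congr 1
      rw [h3, ← h2, if_pos rfl]
      simp only [PMF.binomial, PMF.ofFintype_apply, h1, Fin.val_last]
    · intro b _ hb
      rw [if_neg]
      rintro rfl
      exact hb rfl
  · rw [Nat.choose_eq_zero_of_lt (by omega), Finset.sum_eq_zero]
    · simp
    · intro b _
      rw [if_neg]
      omega

lemma binomHalf_toOuterMeasure_le (l : ℕ) (P : ℕ → Prop) [DecidablePred P] {d : ℝ}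
    (h : ∑ k ∈ Finset.range (l + 1), (if P k then (l.choose k : ℝ) / 2 ^ l else 0) ≤ d) :
    (binomHalf l).toOuterMeasure {k | P k} ≤ ENNReal.ofReal d := by
  refine le_trans (le_of_eq ?_) (ENNReal.ofReal_le_ofReal h)
  rw [PMF.toOuterMeasure_apply, tsum_eq_sum (s := Finset.range (l + 1)),
    ENNReal.ofReal_sum_of_nonneg]
  · refine Finset.sum_congr rfl fun k _ => ?_
    by_cases hk : P k <;> simp [Set.indicator, hk, binomHalf_apply]
  · intro k _
    split_ifs <;> positivity
  · intro k hk
    rw [Finset.mem_range] at hk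
    simp [Set.indicator, binomHalf_apply, Nat.choose_eq_zero_of_lt (show l < k by omega)]

/-- Chernoff bound for the lower tail of `Binomial(l, 1/2)`. -/
lemma sum_choose_lower_tail_le (l : ℕ) (m s : ℝ) (hs : 0 ≤ s) :
    ∑ k ∈ Finset.range (l + 1), (if (k : ℝ) < m then (l.choose k : ℝ) / 2 ^ l else 0) ≤
      Real.exp (s * (m - l / 2) + l * s ^ 2 / 8) := by
  have hmgf : ∑ k ∈ Finset.range (l + 1), (l.choose k : ℝ) / 2 ^ l * Real.exp (s * (m - k)) =
      Real.exp (s * (m - l / 2)) * Real.cosh (s / 2) ^ l := by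
    have h1 : Real.cosh (s / 2) = Real.exp (s / 2) * ((Real.exp (-s) + 1) / 2) := by
      have : Real.exp (-(s / 2)) = Real.exp (s / 2) * Real.exp (-s) := by
        rw [← Real.exp_add]; ring_nf
      rw [Real.cosh_eq, this]; ring
    have h2 : Real.exp (s * (m - l / 2)) * Real.exp (s / 2) ^ l = Real.exp (s * m) := by
      rw [← Real.exp_nat_mul, ← Real.exp_add]; ring_nf
    rw [h1, mul_pow, ← mul_assoc, h2, div_pow, add_pow, Finset.sum_div, Finset.mul_sum]
    refine Finset.sum_congr rfl fun k _ => ?_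
    have h3 : Real.exp (s * (m - k)) = Real.exp (s * m) * Real.exp (-s) ^ k := by
      rw [← Real.exp_nat_mul, ← Real.exp_add]; ring_nf
    rw [h3, one_pow]; ring
  calc _ ≤ ∑ k ∈ Finset.range (l + 1), (l.choose k : ℝ) / 2 ^ l * Real.exp (s * (m - k)) := by
        refine Finset.sum_le_sum fun k _ => ?_
        split_ifs with hk
        · refine le_mul_of_one_le_right (by positivity) (Real.one_le_exp ?_)
          exact mul_nonneg hs (by linarith)
        · positivity
    _ = Real.exp (s * (m - l / 2)) * Real.cosh (s / 2) ^ l := hmgf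
    _ ≤ Real.exp (s * (m - l / 2)) * Real.exp ((s / 2) ^ 2 / 2) ^ l := by
        gcongr
        exact Real.cosh_le_exp_half_sq _
    _ = _ := by
        rw [← Real.exp_nat_mul, ← Real.exp_add]; ring_nf

lemma sum_choose_upper_tail_eq (l : ℕ) (m : ℝ) :
    ∑ k ∈ Finset.range (l + 1), (if (l : ℝ) - k < m then (l.choose k : ℝ) / 2 ^ l else 0) =
      ∑ k ∈ Finset.range (l + 1), (if (k : ℝ) < m then (l.choose k : ℝ) / 2 ^ l else 0) := by
  rw [← Finset.sum_range_reflect]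
  refine Finset.sum_congr rfl fun k hk => ?_
  have hk : k ≤ l := by rw [Finset.mem_range] at hk; omega
  rw [Nat.add_sub_cancel, Nat.choose_symm hk, Nat.cast_sub hk, sub_sub_cancel]

/-- The Chernoff bound at the threshold below which adjacent binomial weights have ratio
exceeding `e^ε`. -/
lemma sum_choose_tail_le_of_le {ε δ : ℝ} (hε : 0 < ε) (hδ0 : 0 < δ) (hδ1 : δ < 1) {l : ℕ}
    (hl : 20 * ((Real.exp ε + 1) / (Real.exp ε - 1)) ^ 2 * Real.log (2 / δ) ≤ (l : ℝ)) :
    ∑ k ∈ Finset.range (l + 1),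
      (if (k : ℝ) < (l + 1) / (Real.exp ε + 1) then (l.choose k : ℝ) / 2 ^ l else 0) ≤ δ := by
  have he : 1 < Real.exp ε := Real.one_lt_exp_iff.2 hε
  set τ := (Real.exp ε - 1) / (Real.exp ε + 1) with hτ
  have hτ0 : 0 < τ := div_pos (by linarith) (by linarith)
  have hτ1 : τ < 1 := (div_lt_one (by linarith)).2 (by linarith)
  have hm : ((l : ℝ) + 1) / (Real.exp ε + 1) = (l + 1) * ((1 - τ) / 2) := by
    have : Real.exp ε + 1 ≠ 0 := by positivity
    rw [hτ]; field_simp; ring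
  have hinv : (Real.exp ε + 1) / (Real.exp ε - 1) = τ⁻¹ := by rw [hτ, inv_div]
  set L := Real.log (2 / δ) with hL
  have hL2 : Real.log 2 ≤ L := by
    apply Real.log_le_log (by norm_num)
    rw [le_div_iff₀ hδ0]; linarith
  have hlog2 := Real.log_two_gt_d9
  have hl' : 20 * L ≤ l * τ ^ 2 := by
    rw [hinv, inv_pow] at hl
    have h := mul_le_mul_of_nonneg_right hl (sq_nonneg τ)
    have : 20 * (τ ^ 2)⁻¹ * L * τ ^ 2 = 20 * L := by field_simp
    linarith
  have hlτ : 2 ≤ l * τ := by nlinarith [mul_nonneg (Nat.cast_nonneg (α := ℝ) l) hτ0.le]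
  rw [hm]
  refine (sum_choose_lower_tail_le l _ τ hτ0.le).trans ?_
  have hexp : τ * ((l + 1) * ((1 - τ) / 2) - l / 2) + l * τ ^ 2 / 8 ≤ -L := by
    nlinarith [mul_nonneg hτ0.le (sub_nonneg.2 hlτ)]
  calc _ ≤ Real.exp (-L) := Real.exp_le_exp.2 hexp
    _ = δ / 2 := by rw [hL, Real.exp_neg, Real.exp_log (by positivity), inv_div]
    _ ≤ δ := by linarith

lemma choose_succ_mul_succ_cast {l k : ℕ} (hk : k ≤ l) :
    (l.choose (k + 1) : ℝ) * (k + 1) = l.choose k * (l - k) := by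
  have := Nat.choose_succ_right_eq l k
  rw [← Nat.cast_sub hk]
  exact_mod_cast this

lemma choose_succ_le_mul_choose {l k : ℕ} {c : ℝ} (hc : 0 < c)
    (h : ((l : ℝ) + 1) / (c + 1) ≤ k + 1) : (l.choose (k + 1) : ℝ) ≤ c * l.choose k := by
  rcases le_or_gt k l with hk | hk
  · rw [div_le_iff₀ (by linarith)] at h
    have hk1 : (0 : ℝ) < k + 1 := by positivity
    refine le_of_mul_le_mul_right ?_ hk1
    rw [choose_succ_mul_succ_cast hk]
    nlinarith [mul_nonneg (Nat.cast_nonneg (α := ℝ) (l.choose k))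
      (show 0 ≤ c * (k + 1) - (l - k : ℝ) by linarith)]
  · rw [Nat.choose_eq_zero_of_lt (show l < k + 1 by omega)]
    simp only [Nat.cast_zero]; positivity

lemma choose_le_mul_choose_succ {l k : ℕ} {c : ℝ} (hc : 0 < c)
    (h : ((l : ℝ) + 1) / (c + 1) ≤ l - k) : (l.choose k : ℝ) ≤ c * l.choose (k + 1) := by
  have hpos : (0 : ℝ) < l - k := lt_of_lt_of_le (by positivity) h
  have hk : k ≤ l := by
    have : (k : ℝ) ≤ l := by linarith
    exact_mod_cast this
  rw [div_le_iff₀ (by linarith)] at h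
  refine le_of_mul_le_mul_right ?_ hpos
  rw [← choose_succ_mul_succ_cast hk]
  nlinarith [mul_nonneg (Nat.cast_nonneg (α := ℝ) (l.choose (k + 1)))
    (show 0 ≤ c * (l - k) - (k + 1 : ℝ) by linarith)]

lemma map_succ_apply_succ (p : PMF ℕ) (k : ℕ) : p.map (· + 1) (k + 1) = p k := by
  rw [PMF.map_apply, tsum_eq_single k]
  · simp
  · intro b hb
    rw [if_neg]
    omega

lemma map_succ_apply_zero (p : PMF ℕ) : p.map (· + 1) 0 = 0 := by
  simp [PMF.map_apply]

/-- A pointwise ratio bound outside a set of small mass is preserved, as approximate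
indistinguishability, by any randomized post-processing. -/
lemma toOuterMeasure_bind_le {α β : Type*} (p q : PMF α) (f : α → PMF β) (c d : ℝ≥0∞)
    (B : Set α) (h : ∀ a ∉ B, p a ≤ c * q a) (hB : p.toOuterMeasure B ≤ d) (T : Set β) :
    (p.bind f).toOuterMeasure T ≤ c * (q.bind f).toOuterMeasure T + d := by
  rw [PMF.toOuterMeasure_bind_apply, PMF.toOuterMeasure_bind_apply, ← ENNReal.tsum_mul_left]
  refine le_trans ?_ (add_le_add_right hB _)
  rw [PMF.toOuterMeasure_apply, ← ENNReal.tsum_add]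
  refine ENNReal.tsum_le_tsum fun a => ?_
  by_cases ha : a ∈ B
  · rw [Set.indicator_of_mem ha]
    refine le_add_left ?_
    refine mul_le_of_le_one_right' ?_
    exact (MeasureTheory.measure_mono (Set.subset_univ T)).trans_eq
      (((f a).toOuterMeasure_apply_eq_one_iff _).2 (Set.subset_univ _))
  · rw [Set.indicator_of_notMem ha, add_zero, ← mul_assoc]
    gcongr
    exact h a ha

lemma binomHalf_bind_le_map_succ {ε δ : ℝ} (hε : 0 < ε) (hδ0 : 0 < δ) (hδ1 : δ < 1) {l : ℕ}
    (hl : 20 * ((Real.exp ε + 1) / (Real.exp ε - 1)) ^ 2 * Real.log (2 / δ) ≤ (l : ℝ))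
    {β : Type*} (f : ℕ → PMF β) (T : Set β) :
    ((binomHalf l).bind f).toOuterMeasure T ≤
      ENNReal.ofReal (Real.exp ε) * (((binomHalf l).map (· + 1)).bind f).toOuterMeasure T +
        ENNReal.ofReal δ := by
  refine toOuterMeasure_bind_le _ _ f _ _ {k | (k : ℝ) < (l + 1) / (Real.exp ε + 1)} ?_
    (binomHalf_toOuterMeasure_le l _ (sum_choose_tail_le_of_le hε hδ0 hδ1 hl)) T
  intro k hk
  rw [Set.mem_ofPred_eq, not_lt] at hk
  cases k with
  | zero =>
    have : 0 < ((l : ℝ) + 1) / (Real.exp ε + 1) := by positivity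
    rw [Nat.cast_zero] at hk
    linarith
  | succ k =>
    rw [map_succ_apply_succ, binomHalf_apply, binomHalf_apply,
      ← ENNReal.ofReal_mul (Real.exp_pos ε).le, ← mul_div_assoc]
    refine ENNReal.ofReal_le_ofReal (div_le_div_of_nonneg_right ?_ (by positivity))
    exact choose_succ_le_mul_choose (Real.exp_pos ε) (by exact_mod_cast hk)

lemma map_succ_bind_le_binomHalf {ε δ : ℝ} (hε : 0 < ε) (hδ0 : 0 < δ) (hδ1 : δ < 1) {l : ℕ}
    (hl : 20 * ((Real.exp ε + 1) / (Real.exp ε - 1)) ^ 2 * Real.log (2 / δ) ≤ (l : ℝ))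
    {β : Type*} (f : ℕ → PMF β) (T : Set β) :
    (((binomHalf l).map (· + 1)).bind f).toOuterMeasure T ≤
      ENNReal.ofReal (Real.exp ε) * ((binomHalf l).bind f).toOuterMeasure T +
        ENNReal.ofReal δ := by
  refine toOuterMeasure_bind_le _ _ f _ _
    ((· + 1) '' {k : ℕ | (l : ℝ) - k < (l + 1) / (Real.exp ε + 1)}) ?_ ?_ T
  · intro k hk
    cases k with
    | zero => rw [map_succ_apply_zero]; exact zero_le
    | succ k =>
      have hk : ((l : ℝ) + 1) / (Real.exp ε + 1) ≤ l - k := by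
        by_contra hlt
        exact hk ⟨k, not_le.1 hlt, rfl⟩
      rw [map_succ_apply_succ, binomHalf_apply, binomHalf_apply,
        ← ENNReal.ofReal_mul (Real.exp_pos ε).le, ← mul_div_assoc]
      refine ENNReal.ofReal_le_ofReal (div_le_div_of_nonneg_right ?_ (by positivity))
      exact choose_le_mul_choose_succ (Real.exp_pos ε) hk
  · rw [PMF.toOuterMeasure_map_apply, Set.preimage_image_eq _ (add_left_injective 1)]
    refine binomHalf_toOuterMeasure_le l _ ?_
    rw [sum_choose_upper_tail_eq]
    exact sum_choose_tail_le_of_le hε hδ0 hδ1 hl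

lemma sum_fin_two_of_differ {n : ℕ} {x x' : Fin n → Fin 2} {i : Fin n}
    (h : ∀ j, j ≠ i → x j = x' j) (h0 : x i = 0) (h1 : x' i = 1) (s : Finset (Fin n)) :
    ∑ j ∈ s, (x' j : ℕ) = ∑ j ∈ s, (x j : ℕ) + if i ∈ s then 1 else 0 := by
  have hx : ∀ j, (x' j : ℕ) = (x j : ℕ) + if i = j then 1 else 0 := by
    intro j
    by_cases hj : i = j
    · subst hj; simp [h0, h1]
    · rw [h j (Ne.symm hj), if_neg hj, add_zero]
  rw [Finset.sum_congr rfl fun j _ => hx j, Finset.sum_add_distrib, Finset.sum_ite_eq]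

/-- Flipping a stream bit from `0` to `1` amounts to shifting one of the two binomial draws. -/
lemma exists_zsumJoint_eq_bind (lam : ℕ) {n : ℕ} {x x' : Fin n → Fin 2} {i : Fin n}
    (h : ∀ j, j ≠ i → x j = x' j) (h0 : x i = 0) (h1 : x' i = 1) (t : ℕ) :
    ∃ f : ℕ → PMF (ℕ × ℕ), zsumJoint lam n x t = (binomHalf lam).bind f ∧
      zsumJoint lam n x' t = ((binomHalf lam).map (· + 1)).bind f := by
  by_cases hi : (i : ℕ) < t
  · refine ⟨_, rfl, ?_⟩
    rw [PMF.bind_map, zsumJoint]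
    congr 1
    funext a
    simp only [Function.comp_apply]
    congr 1
    funext b
    rw [sum_fin_two_of_differ h h0 h1, sum_fin_two_of_differ h h0 h1]
    simp only [Finset.mem_filter, Finset.mem_univ, true_and, hi, if_true, Prod.mk.injEq]
    omega
  · refine ⟨fun b => (binomHalf lam).bind fun a => PMF.pure
      (a + ∑ i ∈ Finset.univ.filter (fun i : Fin n => (i : ℕ) < t), (x i : ℕ),
        a + (∑ i, (x i : ℕ)) + b), ?_, ?_⟩
    · rw [PMF.bind_comm]
      rfl
    · rw [PMF.bind_map, zsumJoint]
      simp only [Function.comp_def]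
      rw [PMF.bind_comm]
      congr 1
      funext a
      rw [← PMF.bind_pure_comp]
      congr 1
      funext b
      simp only [Function.comp_apply]
      rw [sum_fin_two_of_differ h h0 h1, sum_fin_two_of_differ h h0 h1]
      congr 1
      simp only [Finset.mem_filter, Finset.mem_univ, true_and, hi, if_true, if_false,
        Prod.mk.injEq]
      omega

lemma le_of_mem_support_binomHalf {l k : ℕ} (hk : k ∈ (binomHalf l).support) : k ≤ l := by
  rw [binomHalf, PMF.mem_support_map_iff] at hk
  obtain ⟨i, _, rfl⟩ := hk
  omega

/-- For `ε > 0`, `δ ∈ (0,1)`, and `λ ≥ 20·((e^ε+1)/(e^ε-1))²·ln(2/δ)`, the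
online algorithm `Q_ZSUM` is `(ε, δ)`-pan-private, and on every stream its
output `c̃` always satisfies `0 ≤ c̃ - Σᵢ xᵢ ≤ 2λ`. -/
theorem stmt_11
    (ε δ : ℝ) (hε : 0 < ε) (hδ0 : 0 < δ) (hδ1 : δ < 1)
    (lam : ℕ)
    (hlam : 20 * ((Real.exp ε + 1) / (Real.exp ε - 1)) ^ 2 * Real.log (2 / δ)
      ≤ (lam : ℝ))
    (n : ℕ) :
    -- pan-privacy
    (∀ x x' : Fin n → Fin 2, Neighbor x x' → ∀ t ≤ n, ∀ T : Set (ℕ × ℕ),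
      (zsumJoint lam n x t).toOuterMeasure T ≤
        ENNReal.ofReal (Real.exp ε) * (zsumJoint lam n x' t).toOuterMeasure T +
          ENNReal.ofReal δ) ∧
    -- accuracy: surely ∑ x ≤ c̃ ≤ ∑ x + 2λ
    (∀ x : Fin n → Fin 2,
      ((zsumJoint lam n x 0).map Prod.snd).toOuterMeasure
        {c | (∑ i, (x i : ℕ)) ≤ c ∧ c ≤ (∑ i, (x i : ℕ)) + 2 * lam} = 1) := by
  refine ⟨?_, ?_⟩
  · rintro x x' ⟨i, hi⟩ t _ T
    have hbit : ∀ b : Fin 2, b = 0 ∨ b = 1 := by decide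
    by_cases hxi : x i = x' i
    · have hxx : x = x' := by
        funext j
        by_cases hj : j = i
        · rw [hj, hxi]
        · exact hi j hj
      subst hxx
      refine le_add_right (le_mul_of_one_le_left' ?_)
      rw [ENNReal.one_le_ofReal]
      exact Real.one_le_exp hε.le
    · rcases hbit (x i) with h0 | h1
      · have h1 : x' i = 1 := (hbit (x' i)).resolve_left fun h => hxi (h0.trans h.symm)
        obtain ⟨f, hf, hf'⟩ := exists_zsumJoint_eq_bind lam hi h0 h1 t
        rw [hf, hf']
        exact binomHalf_bind_le_map_succ hε hδ0 hδ1 hlam f T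
      · have h0 : x' i = 0 := (hbit (x' i)).resolve_right fun h => hxi (h1.trans h.symm)
        obtain ⟨f, hf, hf'⟩ :=
          exists_zsumJoint_eq_bind lam (fun j hj => (hi j hj).symm) h0 h1 t
        rw [hf, hf']
        exact map_succ_bind_le_binomHalf hε hδ0 hδ1 hlam f T
  · intro x
    rw [PMF.toOuterMeasure_apply_eq_one_iff]
    intro c hc
    simp only [zsumJoint, PMF.mem_support_map_iff, PMF.mem_support_bind_iff] at hc
    obtain ⟨_, ⟨a, ha, b, hb, rfl⟩, rfl⟩ := hc
    have := le_of_mem_support_binomHalf ha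
    have := le_of_mem_support_binomHalf hb
    simp only [Set.mem_ofPred_eq]
    omega
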